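/- (Minimax regret over ellipsoids.) Let n ≥ 1 and a = (a₁,…,aₙ) with aᵢ > 0 for all i, and let E_a = { θ ∈ ℝⁿ : Σᵢ θᵢ²/aᵢ² ≤ 1 }. Then (1/6000)·inf_{r>0} { Σᵢ log(1 + aᵢ²/r²) + r² } ≤ R*(E_a) ≤ 10·inf_{r>0} { Σᵢ log(1 + aᵢ²/r²) + r² }. -/

import Mathlib

open MeasureTheory ENNReal Real Set

noncomputable section

/-- The ellipsoid `E_a = {θ ∈ ℝⁿ : Σᵢ θᵢ²/aᵢ² ≤ 1}`. -/
def ellipsoid (n : ℕ) (a : Fin n → ℝ) : Set (EuclideanSpace ℝ (Fin n)) :=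
  {θ | ∑ i, θ i ^ 2 / a i ^ 2 ≤ 1}

/-- The Shtarkov integral `(2π)^{-n/2} ∫ exp(-dist(x,A)²/2) dx`. -/
def shtarkov (n : ℕ) (A : Set (EuclideanSpace ℝ (Fin n))) : ℝ≥0∞ :=
  ∫⁻ x, ENNReal.ofReal ((2 * π) ^ (-(n : ℝ) / 2) * Real.exp (-(Metric.infDist x A) ^ 2 / 2))

/-- The minimax regret `R*(A)`, as a real number (finite for nonempty bounded `A`). -/
def regretReal (n : ℕ) (A : Set (EuclideanSpace ℝ (Fin n))) : ℝ :=
  Real.log (shtarkov n A).toReal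

open ProbabilityTheory NNReal

theorem lintegral_fin_prod_eq_prod {n : ℕ} (f : Fin n → ℝ → ℝ≥0∞) (hf : ∀ i, Measurable (f i)) :
    ∫⁻ x : Fin n → ℝ, ∏ i, f i (x i) = ∏ i, ∫⁻ x, f i x := by
  induction n with
  | zero => simp [volume_pi]
  | succ n ih =>
    have hm : Measurable fun y : Fin n → ℝ => ∏ i : Fin n, f i.succ (y i) :=
      Finset.measurable_prod _ fun i _ => (hf i.succ).comp (measurable_pi_apply i)
    rw [Fin.prod_univ_succ, ← ih (fun i => f i.succ) fun i => hf i.succ,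
      ← lintegral_prod_mul (hf 0).aemeasurable hm.aemeasurable,
      ← ((volume_preserving_piFinSuccAbove (fun _ : Fin (n + 1) => ℝ) 0).symm).lintegral_comp
        (f := fun x => ∏ i, f i (x i))
        (Finset.measurable_prod _ fun i _ => (hf i).comp (measurable_pi_apply i))]
    refine lintegral_congr fun x => ?_
    simp [Fin.prod_univ_succ, MeasurableEquiv.piFinSuccAbove]

theorem lintegral_euclideanSpace_prod_eq_prod {n : ℕ} (f : Fin n → ℝ → ℝ≥0∞)
    (hf : ∀ i, Measurable (f i)) :
    ∫⁻ x : EuclideanSpace ℝ (Fin n), ∏ i, f i (x i) = ∏ i, ∫⁻ x, f i x := by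
  rw [← lintegral_fin_prod_eq_prod f hf]
  exact (PiLp.volume_preserving_ofLp (Fin n)).lintegral_comp
    (Finset.measurable_prod _ fun i _ => (hf i).comp (measurable_pi_apply i))

theorem gaussian_density_eq_prod {n : ℕ} (y : Fin n → ℝ) :
    (2 * π) ^ (-(n : ℝ) / 2) * Real.exp (-(∑ i, y i ^ 2) / 2)
      = ∏ i, gaussianPDFReal 0 1 (y i) := by
  have h : (2 * π) ^ (-(n : ℝ) / 2) = ((√(2 * π))⁻¹) ^ n := by
    rw [Real.sqrt_eq_rpow, ← Real.rpow_neg (by positivity), ← Real.rpow_natCast,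
      ← Real.rpow_mul (by positivity)]
    congr 1
    ring
  simp only [gaussianPDFReal, NNReal.coe_one, mul_one, sub_zero, Finset.prod_mul_distrib,
    Finset.prod_const, Finset.card_univ, Fintype.card_fin, ← Real.exp_sum, h]
  rw [← Finset.sum_div, Finset.sum_neg_distrib]

theorem lintegral_gaussianPDF_dist_Icc_ge {b : ℝ} (hb : 0 ≤ b) :
    ENNReal.ofReal (1 + b / 2) ≤ ∫⁻ x, gaussianPDF 0 1 (x - max (-b) (min b x)) := by
  set g := gaussianPDF 0 1 with hg
  have hgm : Measurable g := measurable_gaussianPDF 0 1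
  have hA : Measurable ((Iio (0 : ℝ)).indicator g) := hgm.indicator measurableSet_Iio
  have hB : Measurable ((Ici (0 : ℝ)).indicator g) := hgm.indicator measurableSet_Ici
  have hle : ∀ x, ((Iio (0 : ℝ)).indicator g (x + b) + (Ici (0 : ℝ)).indicator g (x - b))
      + (Ioo (-b) b).indicator (fun _ => g 0) x ≤ g (x - max (-b) (min b x)) := by
    intro x
    rcases lt_or_ge (x + b) 0 with h1 | h1
    · have h2 : x - b ∉ Ici (0 : ℝ) := by simp only [mem_Ici]; linarith
      have h3 : x ∉ Ioo (-b) b := fun h => by linarith [h.1]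
      rw [min_eq_right (by linarith), max_eq_left (by linarith)]
      simp [h1, h2, h3]
    · have h1' : x + b ∉ Iio (0 : ℝ) := by simpa using h1
      rcases le_or_gt 0 (x - b) with h2 | h2
      · have h3 : x ∉ Ioo (-b) b := fun h => by linarith [h.2]
        have h2' : x - b ∈ Ici (0 : ℝ) := h2
        rw [min_eq_left (by linarith), max_eq_right (by linarith)]
        simp only [indicator_of_notMem h1', indicator_of_notMem h3, indicator_of_mem h2']
        simp
      · have h2' : x - b ∉ Ici (0 : ℝ) := by simpa using h2
        rw [min_eq_right (by linarith), max_eq_right (by linarith)]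
        simp only [indicator_of_notMem h1', indicator_of_notMem h2', sub_self, zero_add]
        exact indicator_le_self' (fun _ _ => zero_le) x
  refine le_trans ?_ (lintegral_mono hle)
  have hone : ∫⁻ x, ((Iio (0 : ℝ)).indicator g x + (Ici (0 : ℝ)).indicator g x) = 1 := by
    rw [← lintegral_gaussianPDF_eq_one 0 one_ne_zero]
    refine lintegral_congr fun x => ?_
    rcases lt_or_ge x 0 with h | h
    · simp [h, not_le.2 h, hg]
    · simp [h, not_lt.2 h, hg]
  have hg0 : ENNReal.ofReal (1 / 4) ≤ g 0 := by
    refine ENNReal.ofReal_le_ofReal ?_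
    have h4 : √(2 * π) ≤ 4 := by
      rw [Real.sqrt_le_left (by norm_num)]
      linarith [Real.pi_le_four]
    have : (4 : ℝ)⁻¹ ≤ (√(2 * π))⁻¹ := inv_anti₀ (by positivity) h4
    simpa [gaussianPDFReal] using this
  rw [lintegral_add_left (by fun_prop), lintegral_add_left (by fun_prop),
    lintegral_add_right_eq_self (fun x => (Iio (0 : ℝ)).indicator g x) b,
    lintegral_sub_right_eq_self (fun x => (Ici (0 : ℝ)).indicator g x) b,
    ← lintegral_add_left hA, hone, lintegral_indicator_const measurableSet_Ioo, Real.volume_Ioo,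
    ENNReal.ofReal_add zero_le_one (by positivity), ENNReal.ofReal_one]
  gcongr
  calc ENNReal.ofReal (b / 2) = ENNReal.ofReal (1 / 4) * ENNReal.ofReal (b - -b) := by
        rw [← ENNReal.ofReal_mul (by norm_num)]
        congr 1
        ring
    _ ≤ _ := by gcongr

theorem ellipsoid_nonempty (n : ℕ) (a : Fin n → ℝ) : (ellipsoid n a).Nonempty :=
  ⟨0, by simp [ellipsoid]⟩

theorem shtarkov_ellipsoid_le {n : ℕ} {a : Fin n → ℝ} (ha : ∀ i, 0 < a i) {r : ℝ} (hr : 0 < r) :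
    shtarkov n (ellipsoid n a)
      ≤ ENNReal.ofReal (Real.exp (r ^ 2 / 2) * ∏ i, √(1 + a i ^ 2 / r ^ 2)) := by
  set v : Fin n → ℝ≥0 := fun i => ⟨1 + a i ^ 2 / r ^ 2, by positivity⟩ with hv
  have hv0 : ∀ i, v i ≠ 0 := fun i => by
    rw [← NNReal.coe_ne_zero]
    change 1 + a i ^ 2 / r ^ 2 ≠ 0
    positivity
  have hvc : ∀ i, (v i : ℝ) = 1 + a i ^ 2 / r ^ 2 := fun _ => rfl
  have hvpos : ∀ i, 0 < (v i : ℝ) := fun i => NNReal.coe_pos.2 (pos_iff_ne_zero.2 (hv0 i))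
  have hdist : ∀ x : EuclideanSpace ℝ (Fin n),
      ∑ i, (x i / √(v i)) ^ 2 - r ^ 2 ≤ Metric.infDist x (ellipsoid n a) ^ 2 := by
    intro x
    refine (Real.sqrt_le_left Metric.infDist_nonneg).1
      ((Metric.le_infDist (ellipsoid_nonempty n a)).2 fun θ hθ => ?_)
    rw [Real.sqrt_le_left dist_nonneg, EuclideanSpace.dist_eq,
      Real.sq_sqrt (Finset.sum_nonneg fun i _ => sq_nonneg _)]
    have hpt : ∀ i, (x i / √(v i)) ^ 2 ≤ dist (x i) (θ i) ^ 2 + r ^ 2 * (θ i ^ 2 / a i ^ 2) := by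
      intro i
      have hai := ha i
      rw [div_pow, Real.sq_sqrt (hvpos i).le, hvc, Real.dist_eq, sq_abs]
      have h : (x i - θ i) ^ 2 + r ^ 2 * (θ i ^ 2 / a i ^ 2) - x i ^ 2 / (1 + a i ^ 2 / r ^ 2)
          = ((a i ^ 2 + r ^ 2) * θ i - a i ^ 2 * x i) ^ 2 / (a i ^ 2 * (a i ^ 2 + r ^ 2)) := by
        field_simp
        ring
      have : 0 ≤ ((a i ^ 2 + r ^ 2) * θ i - a i ^ 2 * x i) ^ 2 / (a i ^ 2 * (a i ^ 2 + r ^ 2)) := by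
        positivity
      linarith
    have hsum := Finset.sum_le_sum fun i (_ : i ∈ Finset.univ) => hpt i
    rw [Finset.sum_add_distrib, ← Finset.mul_sum] at hsum
    have hθ' : ∑ i, θ i ^ 2 / a i ^ 2 ≤ 1 := hθ
    nlinarith [sq_nonneg r]
  have hscale : ∀ i (t : ℝ), gaussianPDFReal 0 1 (t / √(v i))
      = √(v i) * gaussianPDFReal 0 (v i) t := by
    intro i t
    have := hvpos i
    simp only [gaussianPDFReal, NNReal.coe_one, mul_one, sub_zero, div_pow,
      Real.sq_sqrt (hvpos i).le]
    rw [Real.sqrt_mul (by positivity : 0 ≤ 2 * π) (v i), mul_inv, ← mul_assoc,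
      mul_comm (√(2 * π))⁻¹ (√(v i))⁻¹, ← mul_assoc,
      mul_inv_cancel₀ (Real.sqrt_pos.2 this).ne', one_mul]
    congr 2
    field_simp
  have hpt : ∀ x : EuclideanSpace ℝ (Fin n),
      ENNReal.ofReal ((2 * π) ^ (-(n : ℝ) / 2)
        * Real.exp (-(Metric.infDist x (ellipsoid n a)) ^ 2 / 2))
      ≤ ENNReal.ofReal (Real.exp (r ^ 2 / 2))
        * ∏ i, ENNReal.ofReal (√(v i)) * gaussianPDF 0 (v i) (x i) := by
    intro x
    calc _ ≤ ENNReal.ofReal (Real.exp (r ^ 2 / 2) * ((2 * π) ^ (-(n : ℝ) / 2)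
          * Real.exp (-(∑ i, (x i / √(v i)) ^ 2) / 2))) := by
          refine ENNReal.ofReal_le_ofReal ?_
          rw [mul_left_comm, ← Real.exp_add]
          gcongr
          linarith [hdist x]
      _ = _ := by
          rw [gaussian_density_eq_prod, ENNReal.ofReal_mul (by positivity),
            ENNReal.ofReal_prod_of_nonneg fun i _ => gaussianPDFReal_nonneg _ _ _]
          congr 1
          refine Finset.prod_congr rfl fun i _ => ?_
          rw [hscale, ENNReal.ofReal_mul (by positivity)]
          rfl
  refine (lintegral_mono hpt).trans_eq ?_
  rw [lintegral_const_mul' _ _ ENNReal.ofReal_ne_top, lintegral_euclideanSpace_prod_eq_prod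
    (fun i t => ENNReal.ofReal (√(v i)) * gaussianPDF 0 (v i) t)
    fun i => (measurable_gaussianPDF 0 (v i)).const_mul _, ENNReal.ofReal_mul (by positivity),
    ENNReal.ofReal_prod_of_nonneg fun i _ => by positivity]
  congr 1
  refine Finset.prod_congr rfl fun i _ => ?_
  rw [lintegral_const_mul' _ _ ENNReal.ofReal_ne_top, lintegral_gaussianPDF_eq_one 0 (hv0 i),
    mul_one, hvc]

theorem le_shtarkov_ellipsoid {n : ℕ} {a b : Fin n → ℝ} (hb : ∀ i, 0 ≤ b i)
    (hab : ∑ i, b i ^ 2 / a i ^ 2 ≤ 1) :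
    ENNReal.ofReal (∏ i, (1 + b i / 2)) ≤ shtarkov n (ellipsoid n a) := by
  rw [ENNReal.ofReal_prod_of_nonneg fun i _ => by linarith [hb i]]
  refine (Finset.prod_le_prod' fun i _ => lintegral_gaussianPDF_dist_Icc_ge (hb i)).trans ?_
  rw [← lintegral_euclideanSpace_prod_eq_prod
    (fun i x => gaussianPDF 0 1 (x - max (-b i) (min (b i) x)))
    fun i => (measurable_gaussianPDF 0 1).comp (by fun_prop)]
  refine lintegral_mono fun x => ?_
  set θ : EuclideanSpace ℝ (Fin n) := WithLp.toLp 2 fun i => max (-b i) (min (b i) (x i)) with hθ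
  have hmem : θ ∈ ellipsoid n a := by
    refine le_trans (Finset.sum_le_sum fun i _ => ?_) hab
    have : θ i ^ 2 ≤ b i ^ 2 := sq_le_sq' (le_max_left _ _)
      (max_le (by linarith [hb i]) (min_le_left _ _))
    gcongr
  have hd : Metric.infDist x (ellipsoid n a) ^ 2
      ≤ ∑ i, (x i - max (-b i) (min (b i) (x i))) ^ 2 := by
    have h := pow_le_pow_left₀ Metric.infDist_nonneg (Metric.infDist_le_dist_of_mem (x := x) hmem) 2
    rw [EuclideanSpace.dist_eq, Real.sq_sqrt (Finset.sum_nonneg fun i _ => sq_nonneg _)] at h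
    simpa [Real.dist_eq, sq_abs, hθ] using h
  simp only [gaussianPDF]
  rw [← ENNReal.ofReal_prod_of_nonneg fun i _ => gaussianPDFReal_nonneg _ _ _,
    ← gaussian_density_eq_prod]
  refine ENNReal.ofReal_le_ofReal ?_
  gcongr

theorem exists_radius_fixed_point {n : ℕ} (hn : 1 ≤ n) {a : Fin n → ℝ} (ha : ∀ i, 0 < a i) :
    ∃ r : ℝ, 0 < r ∧ ∑ i, a i ^ 2 / (r ^ 2 + a i ^ 2) = r ^ 2 := by
  have hn' : (1 : ℝ) ≤ n := by exact_mod_cast hn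
  have hpos : ∀ (t : ℝ) i, 0 < t ^ 2 + a i ^ 2 := fun t i => by have := ha i; positivity
  have hcont : Continuous fun t : ℝ => t ^ 2 - ∑ i, a i ^ 2 / (t ^ 2 + a i ^ 2) := by
    refine (continuous_pow 2).sub (continuous_finsetSum _ fun i _ => ?_)
    exact continuous_const.div (by fun_prop) fun t => (hpos t i).ne'
  have h0 : (0 : ℝ) ^ 2 - ∑ i, a i ^ 2 / ((0 : ℝ) ^ 2 + a i ^ 2) = -n := by
    have : ∀ i, a i ^ 2 / ((0 : ℝ) ^ 2 + a i ^ 2) = 1 := fun i => by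
      have := (ha i).ne'
      field_simp
      simp
    rw [Finset.sum_congr rfl fun i _ => this i]
    simp
  have h1 : 0 ≤ (n : ℝ) ^ 2 - ∑ i, a i ^ 2 / ((n : ℝ) ^ 2 + a i ^ 2) := by
    have : ∑ i, a i ^ 2 / ((n : ℝ) ^ 2 + a i ^ 2) ≤ ∑ _i : Fin n, (1 : ℝ) :=
      Finset.sum_le_sum fun i _ => (div_le_one (hpos _ i)).2 (by nlinarith)
    simp only [Finset.sum_const, Finset.card_univ, Fintype.card_fin, nsmul_eq_mul, mul_one] at this
    nlinarith
  obtain ⟨r, hr, hr0⟩ := intermediate_value_Icc (by positivity : (0 : ℝ) ≤ n) hcont.continuousOn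
    (show (0 : ℝ) ∈ Icc _ _ from ⟨by rw [h0]; linarith, h1⟩)
  refine ⟨r, lt_of_le_of_ne hr.1 ?_, (sub_eq_zero.1 hr0).symm⟩
  rintro rfl
  simp only [h0] at hr0
  linarith

theorem log_one_add_le_four_mul_log {u : ℝ} (hu : 0 ≤ u) :
    Real.log (1 + u) ≤ 4 * Real.log (1 + u / √(1 + u) / 2) := by
  have hw : 1 ≤ √(1 + u) := Real.one_le_sqrt.2 (by linarith)
  have hw2 : √(1 + u) ^ 2 = 1 + u := Real.sq_sqrt (by linarith)
  set w := √(1 + u)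
  have hv : (w - 1) / 2 ≤ u / w / 2 := by
    have : w - 1 ≤ u / w := by
      rw [le_div_iff₀ (by linarith)]
      nlinarith
    linarith
  have h4 : Real.log ((1 + u / w / 2) ^ 4) = 4 * Real.log (1 + u / w / 2) := by
    rw [Real.log_pow]
    norm_num
  rw [← h4]
  refine Real.log_le_log (by linarith) ?_
  have h1 : w ≤ (1 + u / w / 2) ^ 2 := by nlinarith [sq_nonneg (w - 1)]
  calc 1 + u = w ^ 2 := hw2.symm
    _ ≤ ((1 + u / w / 2) ^ 2) ^ 2 := by gcongr
    _ = _ := by ring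

theorem regretReal_ellipsoid_le {n : ℕ} {a : Fin n → ℝ} (ha : ∀ i, 0 < a i)
    (hpos : shtarkov n (ellipsoid n a) ≠ 0) {r : ℝ} (hr : 0 < r) :
    regretReal n (ellipsoid n a) ≤ (∑ i, Real.log (1 + a i ^ 2 / r ^ 2) + r ^ 2) / 2 := by
  have hle := shtarkov_ellipsoid_le ha hr
  have hne : ∀ i, √(1 + a i ^ 2 / r ^ 2) ≠ 0 := fun i => by positivity
  have hlog : Real.log (Real.exp (r ^ 2 / 2) * ∏ i, √(1 + a i ^ 2 / r ^ 2))
      = (∑ i, Real.log (1 + a i ^ 2 / r ^ 2) + r ^ 2) / 2 := by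
    rw [Real.log_mul (by positivity) (Finset.prod_ne_zero_iff.2 fun i _ => hne i), Real.log_exp,
      Real.log_prod fun i _ => hne i, add_div, Finset.sum_div, add_comm]
    congr 1
    exact Finset.sum_congr rfl fun i _ => Real.log_sqrt (by positivity)
  rw [← hlog]
  refine Real.log_le_log
    (ENNReal.toReal_pos hpos (ne_top_of_le_ne_top ENNReal.ofReal_ne_top hle)) ?_
  exact ENNReal.toReal_le_of_le_ofReal (by positivity) hle

theorem exists_radius_le_regretReal_ellipsoid {n : ℕ} (hn : 1 ≤ n) {a : Fin n → ℝ}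
    (ha : ∀ i, 0 < a i) :
    ∃ r : ℝ, 0 < r ∧
      (∑ i, Real.log (1 + a i ^ 2 / r ^ 2) + r ^ 2) / 8 ≤ regretReal n (ellipsoid n a) := by
  obtain ⟨r, hr, hfix⟩ := exists_radius_fixed_point hn ha
  refine ⟨r, hr, ?_⟩
  set u : Fin n → ℝ := fun i => a i ^ 2 / r ^ 2 with hu
  have hu0 : ∀ i, 0 < u i := fun i => by have := ha i; positivity
  set b : Fin n → ℝ := fun i => u i / √(1 + u i) with hb
  have hb0 : ∀ i, 0 ≤ b i := fun i => div_nonneg (hu0 i).le (Real.sqrt_nonneg _)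
  have hab : ∑ i, b i ^ 2 / a i ^ 2 ≤ 1 := by
    have : ∀ i, b i ^ 2 / a i ^ 2 = a i ^ 2 / (r ^ 2 + a i ^ 2) / r ^ 2 := fun i => by
      have := ha i
      simp only [hb]
      rw [div_pow, Real.sq_sqrt (by linarith [hu0 i])]
      simp only [hu]
      field_simp
    rw [Finset.sum_congr rfl fun i _ => this i, ← Finset.sum_div, hfix, div_self (by positivity)]
  have hlow := le_shtarkov_ellipsoid hb0 hab
  have hne : ∀ i, 1 + b i / 2 ≠ 0 := fun i => by linarith [hb0 i]
  have hppos : 0 < ∏ i, (1 + b i / 2) := Finset.prod_pos fun i _ => by linarith [hb0 i]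
  have hreg : ∑ i, Real.log (1 + b i / 2) ≤ regretReal n (ellipsoid n a) := by
    rw [← Real.log_prod fun i _ => hne i]
    refine Real.log_le_log hppos ((ENNReal.ofReal_le_iff_le_toReal ?_).1 hlow)
    exact ne_top_of_le_ne_top ENNReal.ofReal_ne_top (shtarkov_ellipsoid_le ha hr)
  have hr2 : r ^ 2 ≤ ∑ i, Real.log (1 + u i) := by
    rw [← hfix]
    refine Finset.sum_le_sum fun i _ => ?_
    have h := Real.one_sub_inv_le_log_of_pos (show 0 < 1 + u i by linarith [hu0 i])
    refine le_trans (le_of_eq ?_) h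
    have := ha i
    simp only [hu]
    field_simp
    ring
  have h4 : ∑ i, Real.log (1 + u i) ≤ 4 * ∑ i, Real.log (1 + b i / 2) := by
    rw [Finset.mul_sum]
    exact Finset.sum_le_sum fun i _ => log_one_add_le_four_mul_log (hu0 i).le
  linarith

/-- Minimax regret over ellipsoids:
`(1/6000)·inf_{r>0} {Σᵢ log(1 + aᵢ²/r²) + r²} ≤ R*(E_a) ≤ 10·inf_{r>0} {Σᵢ log(1 + aᵢ²/r²) + r²}`. -/
theorem regret_ellipsoid (n : ℕ) (hn : 1 ≤ n) (a : Fin n → ℝ) (ha : ∀ i, 0 < a i) :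
    (1 / 6000 : ℝ) * (⨅ r : Set.Ioi (0 : ℝ), ((∑ i, Real.log (1 + a i ^ 2 / (r : ℝ) ^ 2)) + (r : ℝ) ^ 2))
        ≤ regretReal n (ellipsoid n a) ∧
    regretReal n (ellipsoid n a)
        ≤ 10 * (⨅ r : Set.Ioi (0 : ℝ), ((∑ i, Real.log (1 + a i ^ 2 / (r : ℝ) ^ 2)) + (r : ℝ) ^ 2)) := by
  have hnonneg : ∀ r : Set.Ioi (0 : ℝ),
      0 ≤ (∑ i, Real.log (1 + a i ^ 2 / (r : ℝ) ^ 2)) + (r : ℝ) ^ 2 := fun r =>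
    add_nonneg (Finset.sum_nonneg fun i _ => Real.log_nonneg (by
      have : 0 ≤ a i ^ 2 / (r : ℝ) ^ 2 := by positivity
      linarith)) (sq_nonneg _)
  have hpos : shtarkov n (ellipsoid n a) ≠ 0 := by
    have h := le_shtarkov_ellipsoid (a := a) (b := 0) (fun _ => le_rfl) (by simp)
    refine (lt_of_lt_of_le ?_ h).ne'
    simp
  have : Nonempty (Set.Ioi (0 : ℝ)) := ⟨⟨1, mem_Ioi.2 zero_lt_one⟩⟩
  constructor
  · obtain ⟨r, hr, hle⟩ := exists_radius_le_regretReal_ellipsoid hn ha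
    have hinf := ciInf_le ⟨(0 : ℝ), forall_mem_range.2 hnonneg⟩ (⟨r, hr⟩ : Set.Ioi (0 : ℝ))
    have h0 := Real.iInf_nonneg hnonneg
    linarith
  · have h : regretReal n (ellipsoid n a) / 10 ≤
        ⨅ r : Set.Ioi (0 : ℝ), ((∑ i, Real.log (1 + a i ^ 2 / (r : ℝ) ^ 2)) + (r : ℝ) ^ 2) :=
      le_ciInf fun r => by
        have := regretReal_ellipsoid_le ha hpos r.2
        linarith [hnonneg r]
    linarith
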